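/- Let (x,y,z) be a generic triple of octonions, i.e. x = x₁ + x₂ i, y = y₁ + y₂ i + y₃ j, z = z₁ + z₂ i + z₃ j + z₄ k + z₈ ℓ with all coefficients real. Then the associator satisfies [x,y,z] = (xy)z − x(yz) = 2 x₂ y₃ z₈ (kℓ), where kℓ denotes the product of k and ℓ in 𝕆. In particular, [x,y,z] ≠ 0 if and only if x₂ y₃ z₈ ≠ 0. -/

import Mathlib

noncomputable section

/-- The octonions, as the Cayley–Dickson double of the quaternions. -/
def Octonion : Type := Quaternion ℝ × Quaternion ℝ

namespace Octonion

instance : AddCommGroup Octonion :=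
  inferInstanceAs (AddCommGroup (Quaternion ℝ × Quaternion ℝ))

instance : Module ℝ Octonion :=
  inferInstanceAs (Module ℝ (Quaternion ℝ × Quaternion ℝ))

/-- Cayley–Dickson multiplication: (a,b)·(c,d) = (a c − conj(d) b, d a + b conj(c)). -/
instance : Mul Octonion :=
  ⟨fun x y => (x.1 * y.1 - star y.2 * x.2, y.2 * x.1 + x.2 * star y.1)⟩

instance : One Octonion := ⟨((1 : Quaternion ℝ), 0)⟩

/-- Octonionic conjugation: conj (a,b) = (conj a, −b). -/
def conj (x : Octonion) : Octonion := (star x.1, -x.2)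

/-- Real part of an octonion. -/
def re (x : Octonion) : ℝ := x.1.re

/-- Imaginary part of an octonion. -/
def im (x : Octonion) : Octonion := x - re x • 1

/-- Embedding of the reals into the octonions. -/
def ofReal (r : ℝ) : Octonion := (((r : ℝ) : Quaternion ℝ), 0)

/-- The squared norm |w|² (the real scalar such that w · conj w = |w|² · 1). -/
def normSq (x : Octonion) : ℝ := Quaternion.normSq x.1 + Quaternion.normSq x.2

/-- The imaginary unit i. -/
def i : Octonion := ((⟨0, 1, 0, 0⟩ : Quaternion ℝ), 0)

/-- The imaginary unit j. -/
def j : Octonion := ((⟨0, 0, 1, 0⟩ : Quaternion ℝ), 0)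

/-- The imaginary unit k. -/
def k : Octonion := ((⟨0, 0, 0, 1⟩ : Quaternion ℝ), 0)

/-- The imaginary unit ℓ. -/
def l : Octonion := ((0 : Quaternion ℝ), (1 : Quaternion ℝ))

/-- The associator [x,y,z] = (xy)z − x(yz). -/
def assoc (x y z : Octonion) : Octonion := x * y * z - x * (y * z)

/-- A Jordan matrix: a 3×3 Hermitian matrix over the octonions. -/
def IsHermitian (A : Matrix (Fin 3) (Fin 3) Octonion) : Prop :=
  ∀ p q : Fin 3, conj (A q p) = A p q

/-- The right eigenvalue equation `A v = v λ`, componentwise. -/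
def Eig (A : Matrix (Fin 3) (Fin 3) Octonion) (v : Fin 3 → Octonion) (lam : Octonion) : Prop :=
  ∀ p : Fin 3, A p 0 * v 0 + A p 1 * v 1 + A p 2 * v 2 = v p * lam

end Octonion

namespace Octonion

@[simp] lemma fst_add (x y : Octonion) : (x + y).1 = x.1 + y.1 := rfl
@[simp] lemma snd_add (x y : Octonion) : (x + y).2 = x.2 + y.2 := rfl
@[simp] lemma fst_sub (x y : Octonion) : (x - y).1 = x.1 - y.1 := rfl
@[simp] lemma snd_sub (x y : Octonion) : (x - y).2 = x.2 - y.2 := rfl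
@[simp] lemma fst_smul (r : ℝ) (x : Octonion) : (r • x).1 = r • x.1 := rfl
@[simp] lemma snd_smul (r : ℝ) (x : Octonion) : (r • x).2 = r • x.2 := rfl
@[simp] lemma fst_mul (x y : Octonion) : (x * y).1 = x.1 * y.1 - star y.2 * x.2 := rfl
@[simp] lemma snd_mul (x y : Octonion) : (x * y).2 = y.2 * x.1 + x.2 * star y.1 := rfl
@[simp] lemma fst_one : (1 : Octonion).1 = 1 := rfl
@[simp] lemma snd_one : (1 : Octonion).2 = 0 := rfl
@[simp] lemma re_fst_i : i.1.re = 0 := rfl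
@[simp] lemma imI_fst_i : i.1.imI = 1 := rfl
@[simp] lemma imJ_fst_i : i.1.imJ = 0 := rfl
@[simp] lemma imK_fst_i : i.1.imK = 0 := rfl
@[simp] lemma snd_i : i.2 = 0 := rfl
@[simp] lemma re_fst_j : j.1.re = 0 := rfl
@[simp] lemma imI_fst_j : j.1.imI = 0 := rfl
@[simp] lemma imJ_fst_j : j.1.imJ = 1 := rfl
@[simp] lemma imK_fst_j : j.1.imK = 0 := rfl
@[simp] lemma snd_j : j.2 = 0 := rfl
@[simp] lemma re_fst_k : k.1.re = 0 := rfl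
@[simp] lemma imI_fst_k : k.1.imI = 0 := rfl
@[simp] lemma imJ_fst_k : k.1.imJ = 0 := rfl
@[simp] lemma imK_fst_k : k.1.imK = 1 := rfl
@[simp] lemma snd_k : k.2 = 0 := rfl
@[simp] lemma fst_l : l.1 = 0 := rfl
@[simp] lemma snd_l : l.2 = 1 := rfl

lemma k_mul_l_ne_zero : k * l ≠ 0 := by
  intro h
  have h' : (k * l).2.imK = 0 := congrArg (fun w : Octonion => w.2.imK) h
  simp at h'

end Octonion

open Octonion in
/-- For a generic triple of octonions, the associator is `2 x₂ y₃ z₈ (kℓ)`,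
which is nonzero iff `x₂ y₃ z₈ ≠ 0`. -/
theorem assoc_generic (x y z : Octonion) (x₁ x₂ y₁ y₂ y₃ z₁ z₂ z₃ z₄ z₈ : ℝ)
    (hx : x = x₁ • 1 + x₂ • i)
    (hy : y = y₁ • 1 + y₂ • i + y₃ • j)
    (hz : z = z₁ • 1 + z₂ • i + z₃ • j + z₄ • k + z₈ • l) :
    assoc x y z = (2 * x₂ * y₃ * z₈) • (k * l) ∧
    (assoc x y z ≠ 0 ↔ x₂ * y₃ * z₈ ≠ 0) := by
  have h : assoc x y z = (2 * x₂ * y₃ * z₈) • (k * l) := by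
    subst hx hy hz
    open scoped Quaternion in
    refine Prod.ext ?_ ?_ <;> ext <;> simp [assoc] <;> ring
  refine ⟨h, ?_⟩
  rw [h, smul_ne_zero_iff_left k_mul_l_ne_zero]
  simp [mul_assoc]
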